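/- arXiv:math/0301098 — 5 statements merged into one kernel-verified Lean document; each statement's English description precedes it below -/
import Mathlib

section
/- Let 𝒜 be an abelian category, let 𝒞 be a Serre class in 𝒜, and let L : 𝒜 ⥤ 𝒜' be a localization functor for the class of morphisms of 𝒜 whose kernel and cokernel both lie in 𝒞 (so 𝒜' is the quotient abelian category 𝒜/𝒞). Let A be an object with Hom(A, X) = 0 for every object X of 𝒞 (i.e. A ∈ ⊥𝒞), and let B be an object with Hom(X, B) = 0 for every object X of 𝒞 (i.e. B ∈ 𝒞⊥). Then the map Hom_𝒜(A, B) → Hom_{𝒜'}(L.obj A, L.obj B) induced by L is bijective. -/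
open CategoryTheory CategoryTheory.Limits

universe v u v' u'

namespace CategoryTheory.ObjectProperty

variable {C : Type u} [Category.{v} C] [Abelian C] {P : ObjectProperty C} [P.IsSerreClass]

/-- A morphism which is a monomorphism modulo a Serre class is a monomorphism if its source
is right orthogonal to the class. -/
lemma monoModSerre.mono_of_hom_eq_zero {X Y : C}
    {s : X ⟶ Y} (hs : P.monoModSerre s) (hX : ∀ Z, P Z → ∀ f : Z ⟶ X, f = 0) : Mono s :=
  Preadditive.mono_of_kernel_zero (hX _ hs _)

/-- A morphism which is an epimorphism modulo a Serre class is an epimorphism if its target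
is left orthogonal to the class. -/
lemma epiModSerre.epi_of_hom_eq_zero {X Y : C}
    {s : X ⟶ Y} (hs : P.epiModSerre s) (hY : ∀ Z, P Z → ∀ f : Y ⟶ Z, f = 0) : Epi s :=
  Preadditive.epi_of_cokernel_zero (hY _ hs _)

variable (P) in
/-- A localization functor at a Serre class induces a bijection on the morphisms from a left
orthogonal object to a right orthogonal object. -/
lemma bijective_map_of_hom_eq_zero {D : Type u'} [Category.{v'} D] (L : C ⥤ D)
    [L.IsLocalization P.isoModSerre] {A B : C}
    (hA : ∀ X, P X → ∀ f : A ⟶ X, f = 0) (hB : ∀ X, P X → ∀ f : X ⟶ B, f = 0) :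
    Function.Bijective (fun f : A ⟶ B => L.map f) := by
  constructor
  · intro f g hfg
    obtain ⟨Z, s, hs, h⟩ := (MorphismProperty.map_eq_iff_postcomp L P.isoModSerre f g).1 hfg
    have := monoModSerre.mono_of_hom_eq_zero hs.1 hB
    exact (cancel_mono s).1 h
  · intro φ
    obtain ⟨ψ, rfl⟩ := Localization.exists_rightFraction L P.isoModSerre φ
    have := epiModSerre.epi_of_hom_eq_zero ψ.hs.2 hA
    have := Localization.inverts L P.isoModSerre _ ψ.hs
    refine ⟨Abelian.epiDesc ψ.s ψ.f (hB _ ψ.hs.1 _), ?_⟩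
    rw [← cancel_epi (L.map ψ.s), ψ.map_s_comp_map, ← L.map_comp, Abelian.comp_epiDesc]

end CategoryTheory.ObjectProperty

/-- let `𝒞` be a Serre class in an abelian category `𝒜` (a class of objects
containing the zero objects and closed under subobjects, quotients and extensions), and let
`L : 𝒜 ⥤ 𝒜'` be a localization functor at the class `W` of morphisms whose kernel and
cokernel lie in `𝒞` (so `𝒜'` is the quotient `𝒜/𝒞`).  If `Hom(A, X) = 0` and
`Hom(X, B) = 0` for every `X ∈ 𝒞`, then `L` induces a bijection
`Hom_𝒜(A, B) ≃ Hom_{𝒜'}(L A, L B)`. -/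
theorem stmt_0 {𝒜 : Type u} [Category.{v} 𝒜] [Abelian 𝒜]
    {𝒜' : Type u'} [Category.{v'} 𝒜']
    (𝒞 : 𝒜 → Prop)
    (hzero : ∀ X : 𝒜, IsZero X → 𝒞 X)
    (hsub : ∀ {X Y : 𝒜} (f : X ⟶ Y), Mono f → 𝒞 Y → 𝒞 X)
    (hquot : ∀ {X Y : 𝒜} (f : X ⟶ Y), Epi f → 𝒞 X → 𝒞 Y)
    (hext : ∀ S : ShortComplex 𝒜, S.ShortExact → 𝒞 S.X₁ → 𝒞 S.X₃ → 𝒞 S.X₂)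
    (W : MorphismProperty 𝒜)
    (hW : ∀ {X Y : 𝒜} (f : X ⟶ Y), W f ↔ (𝒞 (kernel f) ∧ 𝒞 (cokernel f)))
    (L : 𝒜 ⥤ 𝒜') [L.IsLocalization W]
    (A B : 𝒜)
    (hA : ∀ X : 𝒜, 𝒞 X → ∀ f : A ⟶ X, f = 0)
    (hB : ∀ X : 𝒜, 𝒞 X → ∀ f : X ⟶ B, f = 0) :
    Function.Bijective (fun f : A ⟶ B => L.map f) := by
  let P : ObjectProperty 𝒜 := 𝒞
  have : P.IsSerreClass :=
    { exists_zero := ⟨_, isZero_zero 𝒜, hzero _ (isZero_zero 𝒜)⟩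
      prop_of_mono := fun f hf hY => hsub f hf hY
      prop_of_epi := fun f hf hX => hquot f hf hX
      prop_X₂_of_shortExact := fun hS h₁ h₃ => hext _ hS h₁ h₃ }
  obtain rfl : W = P.isoModSerre := by
    ext X Y f
    exact hW f
  exact P.bijective_map_of_hom_eq_zero L hA hB
end

section
/- Let 𝒜 be an abelian category in which Ext-groups exist. Let 0 → A → X → I → 0 and 0 → I → Y → B → 0 be short exact sequences in 𝒜 (so that splicing them gives a four-term exact sequence 0 → A → X → Y → B → 0, where the map g : X → Y is the composite of the epimorphism X ↠ I and the monomorphism I ↪ Y). Assume that the Yoneda composition of the extension class of 0 → I → Y → B → 0 (an element of Ext¹(B, I)) with the extension class of 0 → A → X → I → 0 (an element of Ext¹(I, A)) vanishes in Ext²(B, A). Then there exist an object M, a monomorphism i : X → M, and an epimorphism p : M → Y such that: (1) i ≫ p = g; (2) the sequence 0 → A → M → Y → 0 is short exact, where A → M is the composite of A → X with i, and M → Y is p; (3) the sequence 0 → X → M → B → 0 is short exact, where X → M is i, and M → B is the composite of p with Y → B. -/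
open CategoryTheory CategoryTheory.Limits CategoryTheory.Abelian

universe w v u

section

open Pretriangulated DerivedCategory

variable {C : Type u} [Category.{v} C] [Abelian C]

/-- A distinguished triangle in the derived category whose first two morphisms come from
morphisms `f` and `g` in the abelian category yields a short exact sequence. -/
lemma CategoryTheory.ShortComplex.shortExact_of_singleFunctor_distinguished
    [HasDerivedCategory.{w} C] (S : ShortComplex C)
    (δ : (singleFunctor C 0).obj S.X₃ ⟶ ((singleFunctor C 0).obj S.X₁)⟦(1 : ℤ)⟧)
    (hδ : Triangle.mk ((singleFunctor C 0).map S.f) ((singleFunctor C 0).map S.g) δ ∈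
      distTriang (DerivedCategory C)) :
    S.ShortExact := by
  have h_exact := HomologySequence.exact₂ _ hδ 0
  have h_mono := (HomologySequence.mono_homologyMap_mor₁_iff _ hδ (-1) 0).2
    ((isZero_of_isGE ((singleFunctor C 0).obj S.X₃) 0 (-1) (by lia)).eq_of_src _ _)
  have h_epi := (HomologySequence.epi_homologyMap_mor₂_iff _ hδ 0 1).2
    ((isZero_of_isLE ((singleFunctor C 0).obj S.X₁) 0 1 (by lia)).eq_of_tgt _ _)
  have h : (S.map (singleFunctor C 0 ⋙ DerivedCategory.homologyFunctor C 0)).ShortExact :=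
    { exact := h_exact, mono_f := h_mono, epi_g := h_epi }
  exact ShortComplex.shortExact_of_iso
    (S.mapNatIso (singleFunctorCompHomologyFunctorIso C 0)) h

/-- Every morphism `B ⟶ A⟦1⟧` in the derived category, for `A` and `B` in the abelian category,
is the third morphism of a distinguished triangle attached to a short exact sequence. -/
lemma DerivedCategory.exists_shortExact_distinguished [HasDerivedCategory.{w} C] {A B : C}
    (δ : (singleFunctor C 0).obj B ⟶ ((singleFunctor C 0).obj A)⟦(1 : ℤ)⟧) :
    ∃ (M : C) (f : A ⟶ M) (g : M ⟶ B) (w : f ≫ g = 0),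
      (ShortComplex.mk f g w).ShortExact ∧
      Triangle.mk ((singleFunctor C 0).map f) ((singleFunctor C 0).map g) δ ∈
        distTriang (DerivedCategory C) := by
  obtain ⟨K, φ, ψ, hT⟩ := distinguished_cocone_triangle₂ δ
  have : K.IsLE 0 := TStructure.t.isLE₂ _ hT 0
    (inferInstanceAs (((singleFunctor C 0).obj A).IsLE 0))
    (inferInstanceAs (((singleFunctor C 0).obj B).IsLE 0))
  have : K.IsGE 0 := TStructure.t.isGE₂ _ hT 0
    (inferInstanceAs (((singleFunctor C 0).obj A).IsGE 0))
    (inferInstanceAs (((singleFunctor C 0).obj B).IsGE 0))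
  obtain ⟨M, ⟨e⟩⟩ := exists_iso_singleFunctor_obj_of_isGE_of_isLE K 0
  obtain ⟨f, hf⟩ := (singleFunctor C 0).map_surjective (φ ≫ e.hom)
  obtain ⟨g, hg⟩ := (singleFunctor C 0).map_surjective (e.inv ≫ ψ)
  have hTM : Triangle.mk ((singleFunctor C 0).map f) ((singleFunctor C 0).map g) δ ∈
      distTriang (DerivedCategory C) := by
    refine isomorphic_distinguished _ hT _
      (Triangle.isoMk _ _ (Iso.refl _) e.symm (Iso.refl _) ?_ ?_ ?_)
    · change (singleFunctor C 0).map f ≫ e.inv = 𝟙 _ ≫ φ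
      simp [hf]
    · change (singleFunctor C 0).map g ≫ 𝟙 _ = e.inv ≫ ψ
      simp [hg]
    · change δ ≫ (𝟙 _)⟦(1 : ℤ)⟧' = 𝟙 _ ≫ δ
      simp
  have w : f ≫ g = 0 := (singleFunctor C 0).map_injective (by
    rw [Functor.map_comp, Functor.map_zero]
    exact comp_distTriang_mor_zero₁₂ _ hTM)
  exact ⟨M, f, g, w, ShortComplex.shortExact_of_singleFunctor_distinguished _ δ hTM, hTM⟩

/-- If `mk₀ g` composed with `x : Ext Y A 1` is the class of `0 → A → X → I → 0`, then `x` is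
realized by an extension `M` of `Y` by `A` that receives a compatible morphism from `X`. -/
lemma CategoryTheory.ShortComplex.ShortExact.exists_extension_of_mk₀_comp_eq_extClass
    [HasExt.{w} C] {S : ShortComplex C} (hS : S.ShortExact) {Y : C} (g : S.X₃ ⟶ Y)
    (x : Ext Y S.X₁ 1) (hx : (Ext.mk₀ g).comp x (zero_add 1) = hS.extClass) :
    ∃ (M : C) (i : S.X₂ ⟶ M) (p : M ⟶ Y) (w : (S.f ≫ i) ≫ p = 0),
      i ≫ p = S.g ≫ g ∧ (ShortComplex.mk (S.f ≫ i) p w).ShortExact := by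
  let := HasDerivedCategory.standard C
  obtain ⟨M, j, p, w, hM, hT⟩ := DerivedCategory.exists_shortExact_distinguished x.hom
  have hδ : hS.singleδ ≫ (𝟙 _)⟦(1 : ℤ)⟧' = (singleFunctor C 0).map g ≫ x.hom := by
    rw [← hS.extClass_hom, ← hx, Ext.comp_hom, Ext.mk₀_hom, ShiftedHom.mk₀_comp]
    simp
  obtain ⟨b, hb₁, hb₂⟩ := complete_distinguished_triangle_morphism₂ _ _
    hS.singleTriangle_distinguished hT (𝟙 _) ((singleFunctor C 0).map g) hδ
  obtain ⟨i, rfl⟩ := (singleFunctor C 0).map_surjective b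
  obtain rfl : S.f ≫ i = j := (singleFunctor C 0).map_injective (by
    rw [Functor.map_comp]
    exact hb₁.trans (Category.id_comp _))
  have hi : i ≫ p = S.g ≫ g := (singleFunctor C 0).map_injective (by
    rw [Functor.map_comp, Functor.map_comp]
    exact hb₂.symm)
  exact ⟨M, i, p, w, hi, hM⟩

/-- Given a morphism `i` from an extension `X` of `I` by `A` to an extension `M` of `Y` by `A`,
compatible with a monomorphism `I ⟶ Y` with cokernel `B`, the morphism `i` is a monomorphism
with cokernel `B`. -/
lemma CategoryTheory.ShortComplex.ShortExact.shortExact_middle_of_extension_hom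
    {A X I Y B M : C}
    {f₁ : A ⟶ X} {f₂ : X ⟶ I} {w₁ : f₁ ≫ f₂ = 0} (h₁ : (ShortComplex.mk f₁ f₂ w₁).ShortExact)
    {g₁ : I ⟶ Y} {g₂ : Y ⟶ B} {w₂ : g₁ ≫ g₂ = 0} (h₂ : (ShortComplex.mk g₁ g₂ w₂).ShortExact)
    {i : X ⟶ M} {p : M ⟶ Y} {w : (f₁ ≫ i) ≫ p = 0}
    (hM : (ShortComplex.mk (f₁ ≫ i) p w).ShortExact) (hi : i ≫ p = f₂ ≫ g₁)
    (wB : i ≫ p ≫ g₂ = 0) :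
    (ShortComplex.mk i (p ≫ g₂) wB).ShortExact := by
  have : Mono (f₁ ≫ i) := hM.mono_f
  have : Mono g₁ := h₂.mono_f
  have : Epi f₂ := h₁.epi_g
  have : Epi p := hM.epi_g
  have : Epi g₂ := h₂.epi_g
  refine { exact := ?_, mono_f := ?_, epi_g := epi_comp p g₂ }
  · rw [ShortComplex.exact_iff_exact_up_to_refinements]
    intro T m hm
    dsimp at m hm
    obtain ⟨T₁, π₁, _, y, hy⟩ := h₂.exact.exact_up_to_refinements (m ≫ p) (by simpa using hm)
    obtain ⟨T₂, π₂, _, x, hx⟩ := surjective_up_to_refinements_of_epi f₂ y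
    dsimp at y hy hx
    obtain ⟨T₃, π₃, _, a, ha⟩ := hM.exact.exact_up_to_refinements (π₂ ≫ π₁ ≫ m - x ≫ i) (by
      simp [hi, hy, reassoc_of% hx])
    dsimp at a ha
    refine ⟨T₃, π₃ ≫ π₂ ≫ π₁, inferInstance, π₃ ≫ x + a ≫ f₁, ?_⟩
    simp only [Preadditive.comp_sub, sub_eq_iff_eq_add] at ha
    simp [ha, add_comm]
  · refine Preadditive.mono_of_cancel_zero _ fun {T} t ht => ?_
    dsimp at t ht
    have htf : t ≫ f₂ = 0 := by
      rw [← cancel_mono g₁, Category.assoc, ← hi, reassoc_of% ht, zero_comp, zero_comp]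
    have : Mono f₁ := h₁.mono_f
    obtain ⟨s, hs⟩ : ∃ s : T ⟶ A, s ≫ f₁ = t := ⟨h₁.exact.lift t htf, h₁.exact.lift_f t htf⟩
    have : s = 0 := by
      rw [← cancel_mono (f₁ ≫ i), reassoc_of% hs, ht, zero_comp]
    rw [← hs, this, zero_comp]

end

/-- if the Yoneda product of the classes of the two short exact sequences
`0 → A → X → I → 0` and `0 → I → Y → B → 0` vanishes in `Ext²(B, A)`, then the spliced
four-term sequence `0 → A → X → Y → B → 0` (with middle map `g = X ↠ I ↪ Y`) can be
"filled in": there is an object `M` with a mono `i : X ⟶ M` and an epi `p : M ⟶ Y`,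
`i ≫ p = g`, such that `0 → A → M → Y → 0` and `0 → X → M → B → 0` are short exact. -/
theorem stmt_1 {C : Type u} [Category.{v} C] [Abelian C] [HasExt.{w} C]
    (A X I Y B : C)
    (f₁ : A ⟶ X) (f₂ : X ⟶ I) (w₁ : f₁ ≫ f₂ = 0)
    (h₁ : (ShortComplex.mk f₁ f₂ w₁).ShortExact)
    (g₁ : I ⟶ Y) (g₂ : Y ⟶ B) (w₂ : g₁ ≫ g₂ = 0)
    (h₂ : (ShortComplex.mk g₁ g₂ w₂).ShortExact)
    (hvanish : h₂.extClass.comp h₁.extClass (by norm_num) = (0 : Ext B A 2)) :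
    ∃ (M : C) (i : X ⟶ M) (p : M ⟶ Y),
      Mono i ∧ Epi p ∧ i ≫ p = f₂ ≫ g₁ ∧
      ∃ (wA : (f₁ ≫ i) ≫ p = 0) (wB : i ≫ (p ≫ g₂) = 0),
        (ShortComplex.mk (f₁ ≫ i) p wA).ShortExact ∧
        (ShortComplex.mk i (p ≫ g₂) wB).ShortExact := by
  obtain ⟨x, hx⟩ := Ext.contravariant_sequence_exact₁ h₂ A h₁.extClass (by norm_num) hvanish
  obtain ⟨M, i, p, wA, hi, hM⟩ := h₁.exists_extension_of_mk₀_comp_eq_extClass g₁ x hx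
  have wB : i ≫ p ≫ g₂ = 0 := by
    rw [reassoc_of% hi, w₂, comp_zero]
  have hX := h₁.shortExact_middle_of_extension_hom h₂ hM hi wB
  exact ⟨M, i, p, hX.mono_f, hM.epi_g, hi, wA, wB, hM, hX⟩
end

section
/- Let k be a field and 𝒟 a k-linear category whose Hom-spaces are finite-dimensional k-vector spaces, and let (S, α) be a Serre structure on 𝒟: S : 𝒟 ⥤ 𝒟 is a functor equipped with k-linear isomorphisms α_{X,Y} : Hom(X, S Y) ≅ (Hom(Y, X))*, natural in X and Y. Then the functor S is fully faithful. -/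
open CategoryTheory

universe v u

/-- a Serre structure `(S, α)` on a `k`-linear category `𝒟` with
finite-dimensional Hom-spaces (k-linear isomorphisms `Hom(X, S Y) ≅ (Hom(Y, X))*`
natural in `X` and `Y`) forces the functor `S` to be fully faithful. -/
theorem stmt_4 (k : Type*) [Field k] {𝒟 : Type u} [Category.{v} 𝒟]
    [Preadditive 𝒟] [Linear k 𝒟] [∀ X Y : 𝒟, FiniteDimensional k (X ⟶ Y)]
    (S : 𝒟 ⥤ 𝒟)
    (α : ∀ X Y : 𝒟, (X ⟶ S.obj Y) ≃ₗ[k] Module.Dual k (Y ⟶ X))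
    (hα₁ : ∀ {X X' Y : 𝒟} (f : X' ⟶ X) (φ : X ⟶ S.obj Y) (l : Y ⟶ X'),
      α X' Y (f ≫ φ) l = α X Y φ (l ≫ f))
    (hα₂ : ∀ {X Y Y' : 𝒟} (g : Y ⟶ Y') (φ : X ⟶ S.obj Y) (l : Y' ⟶ X),
      α X Y' (φ ≫ S.map g) l = α X Y φ (g ≫ l)) :
    S.Full ∧ S.Faithful := by
  constructor
  -- Fullness: `ξ ↦ α (α⁻¹ ξ ≫ h) (𝟙 _)` lies in a double dual, so it is evaluation at some `g`.
  · refine ⟨fun {Y Y'} h => ?_⟩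
    let F : Module.Dual k (Module.Dual k (Y ⟶ Y')) :=
      LinearMap.applyₗ (𝟙 Y') ∘ₗ (α Y' Y').toLinearMap ∘ₗ
        Linear.rightComp k Y' h ∘ₗ (α Y' Y).symm.toLinearMap
    obtain ⟨g, hg⟩ := (Module.evalEquiv k (Y ⟶ Y')).surjective F
    refine ⟨g, (α _ _).injective (LinearMap.ext fun l => ?_)⟩
    have hF : α Y' Y l g = α Y' Y' (l ≫ h) (𝟙 Y') := by
      simpa [F] using LinearMap.congr_fun hg (α Y' Y l)
    have hl := hα₁ l h (𝟙 Y')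
    have hl' := hα₁ l (S.map g) (𝟙 Y')
    rw [hα₂, Category.comp_id] at hl'
    rw [Category.id_comp] at hl hl'
    rw [← hl, ← hl', hF]
  · refine ⟨fun {Y Y' g g'} h =>
      (Module.evalEquiv k (Y ⟶ Y')).injective (LinearMap.ext fun ξ => ?_)⟩
    obtain ⟨φ, rfl⟩ := (α Y' Y).surjective ξ
    rw [Module.evalEquiv_apply, Module.evalEquiv_apply, Module.Dual.eval_apply,
      Module.Dual.eval_apply, ← Category.comp_id g, ← Category.comp_id g', ← hα₂, ← hα₂, h]
end

section
/- Let k be a field and 𝒟 a k-linear category whose Hom-spaces are finite-dimensional k-vector spaces, and let (S, α) be a Serre structure on 𝒟: S : 𝒟 ⥤ 𝒟 is a functor equipped with k-linear isomorphisms α_{X,Y} : Hom(X, S Y) ≅ (Hom(Y, X))*, natural in X and Y. Then S commutes with every endomorphism of the identity functor: for every natural transformation θ : 𝟭_𝒟 ⟶ 𝟭_𝒟 and every object Y of 𝒟, one has S.map (θ.app Y) = θ.app (S.obj Y). -/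
open CategoryTheory

universe v u

/-- a functor `S` underlying a Serre structure on a `k`-linear category with
finite-dimensional Hom-spaces commutes with every endomorphism of the identity functor:
`S.map (θ.app Y) = θ.app (S.obj Y)` for every `θ : 𝟭 𝒟 ⟶ 𝟭 𝒟` and every object `Y`. -/
theorem stmt_5 (k : Type*) [Field k] {𝒟 : Type u} [Category.{v} 𝒟]
    [Preadditive 𝒟] [Linear k 𝒟] [∀ X Y : 𝒟, FiniteDimensional k (X ⟶ Y)]
    (S : 𝒟 ⥤ 𝒟)
    (α : ∀ X Y : 𝒟, (X ⟶ S.obj Y) ≃ₗ[k] Module.Dual k (Y ⟶ X))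
    (hα₁ : ∀ {X X' Y : 𝒟} (f : X' ⟶ X) (φ : X ⟶ S.obj Y) (l : Y ⟶ X'),
      α X' Y (f ≫ φ) l = α X Y φ (l ≫ f))
    (hα₂ : ∀ {X Y Y' : 𝒟} (g : Y ⟶ Y') (φ : X ⟶ S.obj Y) (l : Y' ⟶ X),
      α X Y' (φ ≫ S.map g) l = α X Y φ (g ≫ l))
    (θ : 𝟭 𝒟 ⟶ 𝟭 𝒟) (Y : 𝒟) :
    S.map (θ.app Y) = θ.app (S.obj Y) := by
  apply (α (S.obj Y) Y).injective
  ext l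
  have h₁ := hα₁ (Y := Y) (θ.app (S.obj Y)) (𝟙 (S.obj Y)) l
  have h₂ := hα₂ (θ.app Y) (𝟙 (S.obj Y)) l
  have hθ : l ≫ θ.app (S.obj Y) = θ.app Y ≫ l := θ.naturality l
  calc α (S.obj Y) Y (S.map (θ.app Y)) l
      = α (S.obj Y) Y (𝟙 (S.obj Y) ≫ S.map (θ.app Y)) l :=
        congrArg (fun φ => α (S.obj Y) Y φ l) (Category.id_comp _).symm
    _ = α (S.obj Y) Y (𝟙 (S.obj Y)) (θ.app Y ≫ l) := h₂
    _ = α (S.obj Y) Y (𝟙 (S.obj Y)) (l ≫ θ.app (S.obj Y)) :=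
        congrArg (α (S.obj Y) Y (𝟙 (S.obj Y))) hθ.symm
    _ = α (S.obj Y) Y (θ.app (S.obj Y) ≫ 𝟙 (S.obj Y)) l := h₁.symm
    _ = α (S.obj Y) Y (θ.app (S.obj Y)) l :=
        congrArg (fun φ => α (S.obj Y) Y φ l) (Category.comp_id _)
end

section
/- Let k be a field and 𝒟 a k-linear category whose Hom-spaces are finite-dimensional k-vector spaces, let S : 𝒟 ⥤ 𝒟 be a functor, and let α and α' be two Serre-duality data for the same functor S, i.e. two families of k-linear isomorphisms α_{X,Y}, α'_{X,Y} : Hom(X, S Y) ≅ (Hom(Y, X))*, each natural in X and Y. Then there exists a natural isomorphism η : 𝟭_𝒟 ≅ 𝟭_𝒟 of the identity functor such that for all objects X, Y, every f : X → S Y and every λ : Y → X one has α'_{X,Y}(f)(λ) = α_{X,Y}(f)(λ ≫ η.app X); in other words, the possible duality data α for a given S form a torsor under the group of invertible natural endomorphisms of the identity functor. -/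
open CategoryTheory

universe v u

/-- A linear isomorphism onto the dual of a vector space separates its vectors. -/
theorem eq_of_forall_dualEquiv_apply_eq {k : Type*} [Field k] {V W : Type*}
    [AddCommGroup V] [Module k V] [AddCommGroup W] [Module k W]
    (e : W ≃ₗ[k] Module.Dual k V) {a b : V} (h : ∀ w, e w a = e w b) : a = b := by
  rw [← sub_eq_zero, ← Module.forall_dual_apply_eq_zero_iff k]
  intro ψ
  obtain ⟨w, rfl⟩ := e.surjective ψ
  rw [map_sub, h, sub_self]

/-- Two isomorphisms `α`, `α'` onto the duals of Hom-spaces that are natural in both variables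
differ by a family of endomorphisms acting compatibly on either side. -/
theorem exists_endomorphisms_comparing_duality {k : Type*} [Field k] {𝒟 : Type u} [Category.{v} 𝒟]
    [Preadditive 𝒟] [Linear k 𝒟] [∀ X Y : 𝒟, FiniteDimensional k (X ⟶ Y)]
    {S : 𝒟 ⥤ 𝒟}
    (α : ∀ X Y : 𝒟, (X ⟶ S.obj Y) ≃ₗ[k] Module.Dual k (Y ⟶ X))
    (hα₁ : ∀ {X X' Y : 𝒟} (f : X' ⟶ X) (φ : X ⟶ S.obj Y) (l : Y ⟶ X'),
      α X' Y (f ≫ φ) l = α X Y φ (l ≫ f))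
    (hα₂ : ∀ {X Y Y' : 𝒟} (g : Y ⟶ Y') (φ : X ⟶ S.obj Y) (l : Y' ⟶ X),
      α X Y' (φ ≫ S.map g) l = α X Y φ (g ≫ l))
    (α' : ∀ X Y : 𝒟, (X ⟶ S.obj Y) ≃ₗ[k] Module.Dual k (Y ⟶ X))
    (hα'₁ : ∀ {X X' Y : 𝒟} (f : X' ⟶ X) (φ : X ⟶ S.obj Y) (l : Y ⟶ X'),
      α' X' Y (f ≫ φ) l = α' X Y φ (l ≫ f))
    (hα'₂ : ∀ {X Y Y' : 𝒟} (g : Y ⟶ Y') (φ : X ⟶ S.obj Y) (l : Y' ⟶ X),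
      α' X Y' (φ ≫ S.map g) l = α' X Y φ (g ≫ l)) :
    ∃ t : ∀ X : 𝒟, X ⟶ X, ∀ (X Y : 𝒟) (f : X ⟶ S.obj Y) (l : Y ⟶ X),
      α' X Y f l = α X Y f (l ≫ t X) ∧ α' X Y f l = α X Y f (t Y ≫ l) := by
  have representing (X : 𝒟) : ∃ t : X ⟶ X, ∀ f : X ⟶ S.obj X, α' X X f (𝟙 X) = α X X f t :=
    ⟨(Module.evalEquiv k (X ⟶ X)).symm
      (Module.Dual.eval k (X ⟶ X) (𝟙 X) ∘ₗ (α' X X).toLinearMap ∘ₗ (α X X).symm.toLinearMap),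
      fun f => by simp [Module.apply_evalEquiv_symm_apply]⟩
  choose t ht using representing
  refine ⟨t, fun X Y f l => ⟨?_, ?_⟩⟩
  · rw [← hα₂, ← ht, hα'₂, Category.comp_id]
  · rw [← hα₁, ← ht, hα'₁, Category.id_comp]

/-- for a fixed functor `S` on a `k`-linear category `𝒟` with
finite-dimensional Hom-spaces, any two Serre-duality data `α`, `α'` for `S` differ by an
invertible natural endomorphism of the identity functor: there is `η : 𝟭 𝒟 ≅ 𝟭 𝒟` with
`α' X Y f l = α X Y f (l ≫ η.app X)` for all `f : X ⟶ S Y` and `l : Y ⟶ X`. -/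
theorem stmt_10 (k : Type*) [Field k] {𝒟 : Type u} [Category.{v} 𝒟]
    [Preadditive 𝒟] [Linear k 𝒟] [∀ X Y : 𝒟, FiniteDimensional k (X ⟶ Y)]
    (S : 𝒟 ⥤ 𝒟)
    (α : ∀ X Y : 𝒟, (X ⟶ S.obj Y) ≃ₗ[k] Module.Dual k (Y ⟶ X))
    (hα₁ : ∀ {X X' Y : 𝒟} (f : X' ⟶ X) (φ : X ⟶ S.obj Y) (l : Y ⟶ X'),
      α X' Y (f ≫ φ) l = α X Y φ (l ≫ f))
    (hα₂ : ∀ {X Y Y' : 𝒟} (g : Y ⟶ Y') (φ : X ⟶ S.obj Y) (l : Y' ⟶ X),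
      α X Y' (φ ≫ S.map g) l = α X Y φ (g ≫ l))
    (α' : ∀ X Y : 𝒟, (X ⟶ S.obj Y) ≃ₗ[k] Module.Dual k (Y ⟶ X))
    (hα'₁ : ∀ {X X' Y : 𝒟} (f : X' ⟶ X) (φ : X ⟶ S.obj Y) (l : Y ⟶ X'),
      α' X' Y (f ≫ φ) l = α' X Y φ (l ≫ f))
    (hα'₂ : ∀ {X Y Y' : 𝒟} (g : Y ⟶ Y') (φ : X ⟶ S.obj Y) (l : Y' ⟶ X),
      α' X Y' (φ ≫ S.map g) l = α' X Y φ (g ≫ l)) :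
    ∃ η : 𝟭 𝒟 ≅ 𝟭 𝒟, ∀ (X Y : 𝒟) (f : X ⟶ S.obj Y) (l : Y ⟶ X),
      α' X Y f l = α X Y f (l ≫ η.hom.app X) := by
  obtain ⟨t, ht⟩ := exists_endomorphisms_comparing_duality α hα₁ hα₂ α' hα'₁ hα'₂
  obtain ⟨s, hs⟩ := exists_endomorphisms_comparing_duality α' hα'₁ hα'₂ α hα₁ hα₂
  have hts (X : 𝒟) : t X ≫ s X = 𝟙 X :=
    eq_of_forall_dualEquiv_apply_eq (α' X X) fun f => by
      rw [← (hs X X f _).1, ← Category.id_comp (t X), ← (ht X X f _).1]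
  have hst (X : 𝒟) : s X ≫ t X = 𝟙 X :=
    eq_of_forall_dualEquiv_apply_eq (α X X) fun f => by
      rw [← (ht X X f _).1, ← Category.id_comp (s X), ← (hs X X f _).1]
  refine ⟨NatIso.ofComponents (fun X => ⟨t X, s X, hts X, hst X⟩) fun {X Y} l => ?_,
    fun X Y f l => (ht X Y f l).1⟩
  exact eq_of_forall_dualEquiv_apply_eq (α Y X) fun f =>
    (ht Y X f l).1.symm.trans (ht Y X f l).2
end
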